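/- Let s ∈ [1, ∞), l ∈ {0,1,2,...}, and M ∈ ℤ, and let k ↦ a_k be a map from {0,...,2^l} ∩ (−∞, M] into ℂ. Then V_s(a_k : k ∈ {0,...,2^l} ∩ (−∞, M]) ≤ 2^{1 − 1/s} Σ_{g=0}^{l} ( Σ over h ∈ {1,...,2^{l−g}} with h·2^g ≤ M of |a_{(h−1)2^g} − a_{h·2^g}|^s )^{1/s}. -/

import Mathlib

open scoped ENNReal

/-- The `s`-variation seminorm of `a` over the index set `Z`, valued in `[0,∞]`. -/
noncomputable def eVar {ι : Type*} [LinearOrder ι] (s : ℝ) (a : ι → ℂ) (Z : Set ι) : ℝ≥0∞ :=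
  ⨆ (J : ℕ) (t : Fin (J + 1) → ι) (_ : StrictMono t) (_ : ∀ j, t j ∈ Z),
    (∑ j : Fin J, (ENNReal.ofReal ‖a (t j.castSucc) - a (t j.succ)‖) ^ s) ^ s⁻¹

/-- Dyadic decomposition of an interval `[m, n]`, with at most two blocks per scale. -/
lemma dyadic_decomp (l : ℕ) : ∀ (a : ℕ → ℂ) (m n : ℕ), m ≤ n → n ≤ 2 ^ l →
    ∃ D : ℕ → Finset ℕ, (∀ g, (D g).card ≤ 2) ∧
      (∀ g, ∀ h ∈ D g, 1 ≤ h ∧ m ≤ (h - 1) * 2 ^ g ∧ h * 2 ^ g ≤ n) ∧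
      ‖a m - a n‖ ≤ ∑ g ∈ Finset.range (l + 1), ∑ h ∈ D g,
        ‖a ((h - 1) * 2 ^ g) - a (h * 2 ^ g)‖ := by
  induction l with
  | zero =>
    intro a m n hmn hn
    rcases hmn.eq_or_lt with rfl | hlt
    · exact ⟨fun _ => ∅, by simp, by simp, by simp⟩
    · have h1 : n = 1 := by simp at hn; omega
      have h0 : m = 0 := by omega
      subst h1 h0
      refine ⟨fun g => if g = 0 then {1} else ∅, ?_, ?_, by simp⟩
      · intro g
        dsimp only; split_ifs <;> simp
      · intro g h hh
        dsimp only at hh; split_ifs at hh with hg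
        · simp at hh
          subst hh hg
          simp
        · simp at hh
  | succ l ih =>
    intro a m n hmn hn
    rcases hmn.eq_or_lt with rfl | hlt
    · exact ⟨fun _ => ∅, by simp, by simp, by simp⟩
    have hn' : n / 2 ≤ 2 ^ l := by rw [pow_succ] at hn; omega
    obtain ⟨D, hc, hD, hsum⟩ := ih (fun k => a (2 * k)) ((m + 1) / 2) (n / 2) (by omega) hn'
    let E : Finset ℕ := (if m % 2 = 1 then {m + 1} else ∅) ∪ (if n % 2 = 1 then {n} else ∅)
    have hE : ‖a m - a (2 * ((m + 1) / 2))‖ + ‖a (2 * (n / 2)) - a n‖ ≤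
        ∑ h ∈ E, ‖a (h - 1) - a h‖ := by
      rcases Nat.mod_two_eq_zero_or_one m with h1 | h1 <;>
      rcases Nat.mod_two_eq_zero_or_one n with h2 | h2
      · have e1 : 2 * ((m + 1) / 2) = m := by omega
        have e2 : 2 * (n / 2) = n := by omega
        simp [E, h1, h2, e1, e2]
      · have e1 : 2 * ((m + 1) / 2) = m := by omega
        have e2 : 2 * (n / 2) = n - 1 := by omega
        simp [E, h1, h2, e1, e2]
      · have e1 : 2 * ((m + 1) / 2) = m + 1 := by omega
        have e2 : 2 * (n / 2) = n := by omega
        simp [E, h1, h2, e1, e2]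
      · have e1 : 2 * ((m + 1) / 2) = m + 1 := by omega
        have e2 : 2 * (n / 2) = n - 1 := by omega
        have hne : m + 1 ≠ n := by omega
        have : E = {m + 1, n} := by ext; simp [E, h1, h2]
        rw [this, Finset.sum_pair hne, e1, e2]
        simp
    refine ⟨fun g => match g with | 0 => E | g + 1 => D g, ?_, ?_, ?_⟩
    · rintro (_ | g)
      · refine (Finset.card_union_le _ _).trans ?_
        split_ifs <;> simp
      · exact hc g
    · rintro (_ | g) h hh
      · simp only [E, Finset.mem_union] at hh
        rcases hh with hh | hh <;> split_ifs at hh <;> simp at hh <;> subst hh <;> simp <;> omega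
      · obtain ⟨p, q, r⟩ := hD g h hh
        refine ⟨p, ?_, ?_⟩
        · rw [pow_succ, ← mul_assoc]; omega
        · rw [pow_succ, ← mul_assoc]; omega
    · rw [Finset.sum_range_succ']
      have e : ∀ x g : ℕ, x * 2 ^ (g + 1) = 2 * (x * 2 ^ g) := by intros; ring
      simp only [e, pow_zero, mul_one]
      have tri : ‖a m - a n‖ ≤ ‖a m - a (2 * ((m + 1) / 2))‖ +
          ‖a (2 * ((m + 1) / 2)) - a (2 * (n / 2))‖ + ‖a (2 * (n / 2)) - a n‖ := by
        have := norm_add₃_le (a := a m - a (2 * ((m + 1) / 2)))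
          (b := a (2 * ((m + 1) / 2)) - a (2 * (n / 2))) (c := a (2 * (n / 2)) - a n)
        simpa using this
      linarith

/-- Minkowski's inequality for a finite family. -/
lemma minkowski_finset {ι κ : Type*} (s : ℝ) (hs : 1 ≤ s) (S : Finset ι) (G : Finset κ)
    (f : ι → κ → ℝ≥0∞) :
    (∑ j ∈ S, (∑ g ∈ G, f j g) ^ s) ^ s⁻¹ ≤ ∑ g ∈ G, (∑ j ∈ S, f j g ^ s) ^ s⁻¹ := by
  classical
  have h0 : 0 < s := by linarith
  induction G using Finset.induction_on with
  | empty => simp [h0]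
  | insert g G hg ih =>
    simp only [Finset.sum_insert hg]
    have := ENNReal.Lp_add_le S (fun j => f j g) (fun j => ∑ g ∈ G, f j g) hs
    simp only [one_div] at this
    exact this.trans (by gcongr)

/-- Bound for the `s`-variation over `{0,...,2^l} ∩ (-∞, M]` by sums over dyadic blocks. -/
theorem statement15 (s : ℝ) (hs : 1 ≤ s) (l : ℕ) (M : ℤ) (a : ℕ → ℂ) :
    eVar s a {k : ℕ | k ≤ 2 ^ l ∧ (k : ℤ) ≤ M} ≤
      ENNReal.ofReal ((2 : ℝ) ^ (1 - 1 / s)) *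
        ∑ g ∈ Finset.range (l + 1),
          (∑ h ∈ (Finset.Icc 1 (2 ^ (l - g))).filter (fun h : ℕ => (h : ℤ) * 2 ^ g ≤ M),
              ENNReal.ofReal ‖a ((h - 1) * 2 ^ g) - a (h * 2 ^ g)‖ ^ s) ^ s⁻¹ := by
  have h0 : 0 < s := by linarith
  unfold eVar
  refine iSup_le fun J => iSup_le fun t => iSup_le fun ht => iSup_le fun hZ => ?_
  have key : ∀ j : Fin J, _ := fun j =>
    dyadic_decomp l a (t j.castSucc) (t j.succ) (ht.monotone j.castSucc_lt_succ.le) (hZ _).1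
  choose D hc hD hsum using key
  set F : ℕ → ℕ → ℝ≥0∞ := fun g h => ENNReal.ofReal ‖a ((h - 1) * 2 ^ g) - a (h * 2 ^ g)‖ with hF
  have step1 : ∀ j : Fin J, ENNReal.ofReal ‖a (t j.castSucc) - a (t j.succ)‖ ≤
      ∑ g ∈ Finset.range (l + 1), ∑ h ∈ D j g, F g h := by
    intro j
    refine (ENNReal.ofReal_le_ofReal (hsum j)).trans ?_
    rw [ENNReal.ofReal_sum_of_nonneg (fun _ _ => Finset.sum_nonneg fun _ _ => norm_nonneg _)]
    refine Finset.sum_le_sum fun g _ => ?_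
    rw [ENNReal.ofReal_sum_of_nonneg (fun _ _ => norm_nonneg _)]
  have hinv : 0 ≤ s⁻¹ := by positivity
  calc _ ≤ (∑ j : Fin J, (∑ g ∈ Finset.range (l + 1), ∑ h ∈ D j g, F g h) ^ s) ^ s⁻¹ := by
        gcongr with j
        exact step1 j
    _ ≤ ∑ g ∈ Finset.range (l + 1), (∑ j : Fin J, (∑ h ∈ D j g, F g h) ^ s) ^ s⁻¹ :=
        minkowski_finset s hs _ _ _
    _ ≤ _ := by
        rw [Finset.mul_sum]
        refine Finset.sum_le_sum fun g hg => ?_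
        have hgl : g ≤ l := by simp at hg; omega
        have e2 : ENNReal.ofReal ((2 : ℝ) ^ (1 - 1 / s)) = ((2 : ℝ≥0∞) ^ (s - 1)) ^ s⁻¹ := by
          rw [← ENNReal.ofReal_rpow_of_pos (by norm_num), ← ENNReal.rpow_mul]
          congr 1
          · simp
          · field_simp
        rw [e2, ← ENNReal.mul_rpow_of_nonneg _ _ hinv]
        gcongr
        have pm : ∀ j : Fin J, (∑ h ∈ D j g, F g h) ^ s ≤
            (2 : ℝ≥0∞) ^ (s - 1) * ∑ h ∈ D j g, F g h ^ s := by
          intro j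
          refine (ENNReal.rpow_sum_le_const_mul_sum_rpow (D j g) (F g) hs).trans ?_
          have hs1 : 0 ≤ s - 1 := by linarith
          gcongr
          exact_mod_cast hc j g
        refine (Finset.sum_le_sum fun j _ => pm j).trans ?_
        rw [← Finset.mul_sum]
        gcongr
        have aux : ∀ i j : Fin J, i < j → Disjoint (D i g) (D j g) := by
          intro i j hij
          rw [Finset.disjoint_left]
          intro h hi hj
          obtain ⟨p, _, q⟩ := hD i g h hi
          obtain ⟨_, r, _⟩ := hD j g h hj
          have hle : t i.succ ≤ t j.castSucc := ht.monotone (by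
            rw [Fin.le_def]; simp; omega)
          have : (h - 1) * 2 ^ g < h * 2 ^ g :=
            Nat.mul_lt_mul_of_pos_right (by omega) (by positivity)
          omega
        rw [← Finset.sum_biUnion]
        · refine Finset.sum_le_sum_of_subset ?_
          intro h hh
          simp only [Finset.mem_biUnion, Finset.mem_univ, true_and] at hh
          obtain ⟨j, hj⟩ := hh
          obtain ⟨p, _, q⟩ := hD j g h hj
          obtain ⟨z1, z2⟩ := hZ j.succ
          simp only [Finset.mem_filter, Finset.mem_Icc]
          refine ⟨⟨p, ?_⟩, ?_⟩
          · have : h * 2 ^ g ≤ 2 ^ (l - g) * 2 ^ g := by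
              rw [← pow_add, Nat.sub_add_cancel hgl]; omega
            exact Nat.le_of_mul_le_mul_right this (by positivity)
          · have : ((h * 2 ^ g : ℕ) : ℤ) ≤ M := by omega
            exact_mod_cast this
        · intro i _ j _ hij
          rcases lt_or_gt_of_ne hij with h | h
          · exact aux i j h
          · exact (aux j i h).symm
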